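/- For every reduced expression w₀ = s_{i₁} s_{i₂} ⋯ s_{i_l} of the longest element, the automorphism τ = τ_{i₁} ∘ τ_{i₂} ∘ ⋯ ∘ τ_{i_l} of g satisfies τ(τ(e_i)) = e_i for every i. (This is the classical, q = 1, statement that the inductively constructed root vectors are consistent: E′_α = E_α; for q ≠ 1 one instead gets E′_α = K_α^{-1} E_α K_α.) -/

import Mathlib

variable {I : Type*} [Fintype I] [DecidableEq I]
variable {L : Type*} [LieRing L] [LieAlgebra ℂ L] [FiniteDimensional ℂ L]

/-- `A` is a Cartan matrix of simply-laced (A, D, E) type: symmetric, with diagonal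
entries `2`, off-diagonal entries `0` or `-1` (so `A i j = (αᵢ, αⱼ)` for the inner
product normalized by `(α, α) = 2`), and connected Dynkin diagram. -/
structure IsADECartanMatrix (A : Matrix I I ℤ) : Prop where
  symm : ∀ i j, A i j = A j i
  diag : ∀ i, A i i = 2
  off_diag : ∀ i j, i ≠ j → A i j = 0 ∨ A i j = -1
  connected : (SimpleGraph.fromRel fun i j => A i j = -1).Connected

/-- The data of a simple Lie algebra `L` over `ℂ` of type A, D or E together with a
splitting Cartan subalgebra and Chevalley generators `eᵢ ∈ g_{αᵢ}`, `fᵢ ∈ g_{-αᵢ}`,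
`hᵢ = [eᵢ, fᵢ]` the coroots, recorded via the standard Chevalley–Serre relations. -/
structure IsChevalleySystem (A : Matrix I I ℤ) (e f h : I → L) : Prop where
  cartan : IsADECartanMatrix A
  simple : LieAlgebra.IsSimple ℂ L
  lie_h_h : ∀ i j, ⁅h i, h j⁆ = 0
  lie_e_f : ∀ i j, ⁅e i, f j⁆ = if i = j then h i else 0
  lie_h_e : ∀ i j, ⁅h i, e j⁆ = (A i j : ℂ) • e j
  lie_h_f : ∀ i j, ⁅h i, f j⁆ = -(A i j : ℂ) • f j
  serre_e : ∀ i j, i ≠ j → ((LieAlgebra.ad ℂ L (e i)) ^ (1 - A i j).toNat) (e j) = 0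
  serre_f : ∀ i j, i ≠ j → ((LieAlgebra.ad ℂ L (f i)) ^ (1 - A i j).toNat) (f j) = 0
  generates : LieSubalgebra.lieSpan ℂ L (Set.range e ∪ Set.range f) = ⊤
  ad_e_nilpotent : ∀ i, IsNilpotent (LieAlgebra.ad ℂ L (e i))
  ad_f_nilpotent : ∀ i, IsNilpotent (LieAlgebra.ad ℂ L (f i))

/-- The exponential of a (nilpotent) endomorphism `a` of the finite-dimensional space `L`:
`exp a = ∑ aⁿ/n!`, where the sum may be truncated at `n = finrank ℂ L` since `a` is
nilpotent. -/
noncomputable def expEnd (a : Module.End ℂ L) : Module.End ℂ L :=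
  ∑ n ∈ Finset.range (Module.finrank ℂ L + 1), (n.factorial : ℂ)⁻¹ • a ^ n

/-- The automorphism `τᵢ = exp(ad eᵢ) ∘ exp(−ad fᵢ) ∘ exp(ad eᵢ)` of `L`, implementing
the simple reflection `sᵢ` on the Cartan subalgebra. -/
noncomputable def chevalleyTau (e f : I → L) (i : I) : Module.End ℂ L :=
  expEnd (LieAlgebra.ad ℂ L (e i)) * expEnd (-(LieAlgebra.ad ℂ L (f i))) *
    expEnd (LieAlgebra.ad ℂ L (e i))

/-- The composition `τ_{i₁} ∘ τ_{i₂} ∘ ⋯ ∘ τ_{i_l}` along a word `ω = (i₁, …, i_l)`. -/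
noncomputable def tauWord (e f : I → L) (ω : List I) : Module.End ℂ L :=
  (ω.map (chevalleyTau e f)).prod

/-- The Coxeter matrix of the Weyl group attached to the Cartan matrix `A`:
`m i j = 1` if `i = j`, `3` if `A i j = -1`, and `2` otherwise. -/
def coxeterMatrixOfCartan (A : Matrix I I ℤ) : CoxeterMatrix I where
  M := Matrix.of fun i j =>
    if i = j then 1 else if A i j = -1 ∨ A j i = -1 then 3 else 2
  isSymm := by
    unfold Matrix.IsSymm
    ext i j
    by_cases h : i = j
    · simp [h]
    · simp only [Matrix.transpose_apply, Matrix.of_apply, if_neg h, if_neg (Ne.symm h)]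
      by_cases h' : A i j = -1 ∨ A j i = -1
      · rw [if_pos h', if_pos (Or.symm h')]
      · rw [if_neg h', if_neg (fun hc => h' (Or.symm hc))]
  diagonal := by intro i; simp
  off_diagonal := by
    intro i j h
    simp only [Matrix.of_apply, if_neg h]
    split <;> omega

section LieSide

lemma pow_finrank_eq_zero (a : Module.End ℂ L) (ha : IsNilpotent a) :
    a ^ (Module.finrank ℂ L) = 0 := by
  have := a.aeval_self_charpoly
  rw [IsNilpotent.charpoly_eq_X_pow_finrank ha] at this
  simpa using this

lemma expEnd_apply_of (a : Module.End ℂ L) (ha : IsNilpotent a) (k : ℕ) (v : L)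
    (hv : (a ^ k) v = 0) :
    expEnd a v = ∑ n ∈ Finset.range k, (n.factorial : ℂ)⁻¹ • (a ^ n) v := by
  have h1 : ∀ n, k ≤ n → (a ^ n) v = 0 := by
    intro n hn
    obtain ⟨m, rfl⟩ := Nat.exists_eq_add_of_le' hn
    rw [pow_add, Module.End.mul_apply, hv, map_zero]
  have h2 : ∀ n, Module.finrank ℂ L + 1 ≤ n → (a ^ n) v = 0 := by
    intro n hn
    rw [pow_eq_zero_of_le (by omega) (pow_finrank_eq_zero a ha), LinearMap.zero_apply]
  rw [expEnd, LinearMap.sum_apply]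
  simp only [LinearMap.smul_apply]
  rcases le_total k (Module.finrank ℂ L + 1) with hk | hk
  · symm
    refine Finset.sum_subset (Finset.range_mono hk) fun n _ hn => ?_
    rw [h1 n (by simpa using hn), smul_zero]
  · refine Finset.sum_subset (Finset.range_mono hk) fun n _ hn => ?_
    rw [h2 n (by simpa using hn), smul_zero]

lemma expEnd_zero (x y : L) (hx : IsNilpotent (LieAlgebra.ad ℂ L x)) (h : ⁅x, y⁆ = 0) :
    expEnd (LieAlgebra.ad ℂ L x) y = y := by
  rw [expEnd_apply_of _ hx 1 y (by simpa using h)]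
  simp

lemma expEnd_one (x y z : L) (hx : IsNilpotent (LieAlgebra.ad ℂ L x)) (h : ⁅x, y⁆ = z)
    (h2 : ⁅x, z⁆ = 0) :
    expEnd (LieAlgebra.ad ℂ L x) y = y + z := by
  rw [expEnd_apply_of _ hx 2 y (by simp [pow_succ, h, h2])]
  simp [Finset.sum_range_succ, h]

lemma expEnd_two (x y z t : L) (hx : IsNilpotent (LieAlgebra.ad ℂ L x)) (h : ⁅x, y⁆ = z)
    (h2 : ⁅x, z⁆ = (2 : ℂ) • t) (h3 : ⁅x, t⁆ = 0) :
    expEnd (LieAlgebra.ad ℂ L x) y = y + z + t := by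
  rw [expEnd_apply_of _ hx 3 y (by simp [pow_succ, h, h2, h3])]
  simp [Finset.sum_range_succ, h, h2, pow_succ, smul_smul]

/-- An endomorphism preserving brackets. -/
def PresLie (φ : Module.End ℂ L) : Prop := ∀ x y : L, φ ⁅x, y⁆ = ⁅φ x, φ y⁆

lemma PresLie.mul {φ ψ : Module.End ℂ L} (h : PresLie φ) (h' : PresLie ψ) : PresLie (φ * ψ) := by
  intro x y
  simp [h' x y, h _ _]

lemma presLie_exp (x : L) (hx : IsNilpotent (LieAlgebra.ad ℂ L x)) :
    PresLie (expEnd (LieAlgebra.ad ℂ L x)) := by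
  intro y z
  letI m : Module ℚ L := Module.compHom L (algebraMap ℚ ℂ)
  letI : LieAlgebra ℚ L := { m with lie_smul := fun q x y => lie_smul (q : ℂ) x y }
  have hexp : expEnd (LieAlgebra.ad ℂ L x) = IsNilpotent.exp (LieAlgebra.ad ℂ L x) := by
    rw [IsNilpotent.exp_eq_sum (pow_eq_zero_of_le (Nat.le_succ _)
      (pow_finrank_eq_zero (LieAlgebra.ad ℂ L x) hx)), expEnd]
    refine Finset.sum_congr rfl fun n _ => ?_
    ext v
    simp only [LinearMap.smul_apply]
    rw [← Rat.cast_smul_eq_qsmul ℂ]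
    simp
  rw [hexp]
  let D : LieDerivation ℂ L L := LieDerivation.ad ℂ L x
  have hD : D.toLinearMap = LieAlgebra.ad ℂ L x := by
    ext y
    simp [D]
  have hn : IsNilpotent D.toLinearMap := by rw [hD]; exact hx
  have := (LieDerivation.exp D hn).map_lie y z
  rw [LieDerivation.exp_map_apply, LieDerivation.exp_map_apply, LieDerivation.exp_map_apply, hD] at this
  exact this

lemma PresLie.comm_exp {φ : Module.End ℂ L} (h : PresLie φ) (x : L) :
    φ * expEnd (LieAlgebra.ad ℂ L x) = expEnd (LieAlgebra.ad ℂ L (φ x)) * φ := by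
  have h1 : ∀ n, φ * (LieAlgebra.ad ℂ L x) ^ n = (LieAlgebra.ad ℂ L (φ x)) ^ n * φ := by
    intro n
    have : SemiconjBy φ (LieAlgebra.ad ℂ L x) (LieAlgebra.ad ℂ L (φ x)) := by
      ext y
      simp [h x y]
    exact this.pow_right n
  simp only [expEnd, Finset.mul_sum, Finset.sum_mul, mul_smul_comm, smul_mul_assoc, h1]

lemma tau_eq (e f : I → L) (i : I) : chevalleyTau e f i =
    expEnd (LieAlgebra.ad ℂ L (e i)) * expEnd (LieAlgebra.ad ℂ L (-(f i))) *
    expEnd (LieAlgebra.ad ℂ L (e i)) := by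
  rw [chevalleyTau, map_neg]

lemma PresLie.comm_tau {φ : Module.End ℂ L} (h : PresLie φ) (e f : I → L) (i j : I)
    (he : φ (e i) = e j) (hf : φ (f i) = f j) :
    φ * chevalleyTau e f i = chevalleyTau e f j * φ := by
  rw [tau_eq, tau_eq, ← mul_assoc, ← mul_assoc, h.comm_exp, mul_assoc _ φ, h.comm_exp,
    mul_assoc, mul_assoc, h.comm_exp, map_neg, he, hf]
  simp only [mul_assoc]

variable {A : Matrix I I ℤ} {e f h : I → L}

namespace IsChevalleySystem

lemma neg_nil (H : IsChevalleySystem A e f h) (i : I) : IsNilpotent (LieAlgebra.ad ℂ L (-(f i))) := by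
  rw [map_neg]; exact (H.ad_f_nilpotent i).neg

lemma presLie_tau (H : IsChevalleySystem A e f h) (i : I) : PresLie (chevalleyTau e f i) := by
  rw [tau_eq]
  exact ((presLie_exp _ (H.ad_e_nilpotent i)).mul (presLie_exp _ (H.neg_nil i))).mul
    (presLie_exp _ (H.ad_e_nilpotent i))

lemma ef (H : IsChevalleySystem A e f h) (i : I) : ⁅e i, f i⁆ = h i := by
  simp [H.lie_e_f]

lemma fe (H : IsChevalleySystem A e f h) (i : I) : ⁅f i, e i⁆ = -h i := by
  rw [← lie_skew, H.ef]

lemma eh (H : IsChevalleySystem A e f h) (i : I) : ⁅e i, h i⁆ = (2 : ℂ) • (-e i) := by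
  rw [← lie_skew, H.lie_h_e, H.cartan.diag]; simp

lemma fh (H : IsChevalleySystem A e f h) (i : I) : ⁅f i, h i⁆ = (2 : ℂ) • f i := by
  rw [← lie_skew, H.lie_h_f, H.cartan.diag]; simp

lemma tau_e_self (H : IsChevalleySystem A e f h) (i : I) : chevalleyTau e f i (e i) = - f i := by
  rw [tau_eq]
  simp only [Module.End.mul_apply]
  rw [expEnd_zero _ _ (H.ad_e_nilpotent i) (lie_self _),
    expEnd_two _ (e i) (h i) (-f i) (H.neg_nil i) (by simp [H.fe]) (by simp [H.fh]) (by simp)]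
  simp only [map_add, map_neg]
  rw [expEnd_zero _ _ (H.ad_e_nilpotent i) (lie_self _),
    expEnd_one _ (h i) _ (H.ad_e_nilpotent i) (H.eh i) (by simp),
    expEnd_two _ (f i) (h i) (- e i) (H.ad_e_nilpotent i) (H.ef i) (H.eh i) (by simp)]
  module

lemma tau_f_self (H : IsChevalleySystem A e f h) (i : I) : chevalleyTau e f i (f i) = - e i := by
  rw [tau_eq]
  simp only [Module.End.mul_apply]
  rw [expEnd_two _ (f i) (h i) (- e i) (H.ad_e_nilpotent i) (H.ef i) (H.eh i) (by simp)]
  simp only [map_add, map_neg (expEnd _)]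
  rw [expEnd_two _ (e i) (h i) (-f i) (H.neg_nil i) (by simp [H.fe]) (by simp [H.fh]) (by simp),
    expEnd_zero _ (f i) (H.neg_nil i) (by simp),
    expEnd_one _ (h i) (-((2 : ℂ) • f i)) (H.neg_nil i) (by simp [H.fh]) (by simp)]
  have : f i + (h i + -((2 : ℂ) • f i)) + -(e i + h i + -f i) = - e i := by module
  rw [← map_neg, ← map_add, ← map_add, this, map_neg, expEnd_zero _ _ (H.ad_e_nilpotent i) (lie_self _)]

lemma e_f (H : IsChevalleySystem A e f h) {i j : I} (hij : i ≠ j) : ⁅e i, f j⁆ = 0 := by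
  simp [H.lie_e_f, hij]

lemma f_e (H : IsChevalleySystem A e f h) {i j : I} (hij : i ≠ j) : ⁅f i, e j⁆ = 0 := by
  rw [← lie_skew, H.e_f hij.symm, neg_zero]

lemma tau_e_zero (H : IsChevalleySystem A e f h) {i j : I} (hij : i ≠ j) (hA : A i j = 0) :
    chevalleyTau e f i (e j) = e j := by
  have h1 : ⁅e i, e j⁆ = 0 := by simpa [hA] using H.serre_e i j hij
  rw [tau_eq]
  simp only [Module.End.mul_apply]
  rw [expEnd_zero _ _ (H.ad_e_nilpotent i) h1, expEnd_zero _ _ (H.neg_nil i) (by simp [H.f_e hij]),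
    expEnd_zero _ _ (H.ad_e_nilpotent i) h1]

lemma tau_f_zero (H : IsChevalleySystem A e f h) {i j : I} (hij : i ≠ j) (hA : A i j = 0) :
    chevalleyTau e f i (f j) = f j := by
  have h1 : ⁅f i, f j⁆ = 0 := by simpa [hA] using H.serre_f i j hij
  rw [tau_eq]
  simp only [Module.End.mul_apply]
  rw [expEnd_zero _ _ (H.ad_e_nilpotent i) (H.e_f hij),
    expEnd_zero _ _ (H.neg_nil i) (by simp [h1]),
    expEnd_zero _ _ (H.ad_e_nilpotent i) (H.e_f hij)]

lemma fee (H : IsChevalleySystem A e f h) {i j : I} (hij : i ≠ j) (hA : A i j = -1) :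
    ⁅f i, ⁅e i, e j⁆⁆ = e j := by
  rw [leibniz_lie, H.fe, H.f_e hij, neg_lie, H.lie_h_e, hA]; simp

lemma eff (H : IsChevalleySystem A e f h) {i j : I} (hij : i ≠ j) (hA : A i j = -1) :
    ⁅e i, ⁅f i, f j⁆⁆ = f j := by
  rw [leibniz_lie, H.ef, H.e_f hij, H.lie_h_f, hA]; simp

lemma tau_e_one (H : IsChevalleySystem A e f h) {i j : I} (hij : i ≠ j) (hA : A i j = -1) :
    chevalleyTau e f i (e j) = ⁅e i, e j⁆ := by
  have h1 : ⁅e i, ⁅e i, e j⁆⁆ = 0 := by simpa [hA, pow_succ] using H.serre_e i j hij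
  rw [tau_eq]
  simp only [Module.End.mul_apply]
  rw [expEnd_one _ (e j) _ (H.ad_e_nilpotent i) rfl h1, map_add,
    expEnd_zero _ (e j) (H.neg_nil i) (by simp [H.f_e hij]),
    expEnd_one _ ⁅e i, e j⁆ (-(e j)) (H.neg_nil i) (by simp [H.fee hij hA]) (by simp [H.f_e hij])]
  have : e j + (⁅e i, e j⁆ + - e j) = ⁅e i, e j⁆ := by abel
  rw [this, expEnd_zero _ _ (H.ad_e_nilpotent i) h1]

lemma tau_f_one (H : IsChevalleySystem A e f h) {i j : I} (hij : i ≠ j) (hA : A i j = -1) :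
    chevalleyTau e f i (f j) = - ⁅f i, f j⁆ := by
  have h1 : ⁅f i, ⁅f i, f j⁆⁆ = 0 := by simpa [hA, pow_succ] using H.serre_f i j hij
  rw [tau_eq]
  simp only [Module.End.mul_apply]
  rw [expEnd_zero _ (f j) (H.ad_e_nilpotent i) (H.e_f hij),
    expEnd_one _ (f j) (-⁅f i, f j⁆) (H.neg_nil i) (neg_lie _ _)
      (by rw [neg_lie, lie_neg, h1, neg_zero, neg_zero]),
    map_add, map_neg, expEnd_zero _ (f j) (H.ad_e_nilpotent i) (H.e_f hij),
    expEnd_one _ ⁅f i, f j⁆ (f j) (H.ad_e_nilpotent i) (H.eff hij hA) (H.e_f hij)]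
  abel

lemma tau_tau_e (H : IsChevalleySystem A e f h) {i j : I} (hij : i ≠ j) (hA : A i j = -1) :
    chevalleyTau e f i (chevalleyTau e f j (e i)) = e j := by
  rw [H.tau_e_one hij.symm (by rw [H.cartan.symm, hA]), H.presLie_tau i, H.tau_e_one hij hA,
    H.tau_e_self, lie_neg, lie_skew, H.fee hij hA]

lemma tau_tau_f (H : IsChevalleySystem A e f h) {i j : I} (hij : i ≠ j) (hA : A i j = -1) :
    chevalleyTau e f i (chevalleyTau e f j (f i)) = f j := by
  rw [H.tau_f_one hij.symm (by rw [H.cartan.symm, hA]), map_neg, H.presLie_tau i,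
    H.tau_f_one hij hA, H.tau_f_self, lie_neg, neg_lie, neg_neg, lie_skew, H.eff hij hA]

lemma braid2 (H : IsChevalleySystem A e f h) {i j : I} (hij : i ≠ j) (hA : A i j = 0) :
    chevalleyTau e f i * chevalleyTau e f j = chevalleyTau e f j * chevalleyTau e f i :=
  (H.presLie_tau i).comm_tau e f j j (H.tau_e_zero hij hA) (H.tau_f_zero hij hA)

lemma braid3 (H : IsChevalleySystem A e f h) {i j : I} (hij : i ≠ j) (hA : A i j = -1) :
    chevalleyTau e f i * chevalleyTau e f j * chevalleyTau e f i =
      chevalleyTau e f j * chevalleyTau e f i * chevalleyTau e f j := by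
  rw [((H.presLie_tau i).mul (H.presLie_tau j)).comm_tau e f i j (H.tau_tau_e hij hA)
    (H.tau_tau_f hij hA), mul_assoc]

end IsChevalleySystem
end LieSide

section CoxeterSide

/-- Pairing with a simple coroot. -/
def bf (A : Matrix I I ℤ) (i : I) (v : I → ℤ) : ℤ := ∑ k, A i k * v k

lemma bf_sub (A : Matrix I I ℤ) (i : I) (v w : I → ℤ) : bf A i (v - w) = bf A i v - bf A i w := by
  simp [bf, mul_sub]

lemma bf_smul_single (A : Matrix I I ℤ) (i j : I) (c : ℤ) :
    bf A i (c • Pi.single j 1) = c * A i j := by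
  simp [bf, Pi.single_apply, mul_comm]

/-- Simple reflection on the root lattice. -/
def rootRefl (A : Matrix I I ℤ) (i : I) : Module.End ℤ (I → ℤ) where
  toFun v := v - (∑ k, A i k * v k) • Pi.single i 1
  map_add' v w := by
    simp only [Pi.add_apply, mul_add, Finset.sum_add_distrib, add_smul]; abel
  map_smul' c v := by
    simp only [Pi.smul_apply, smul_eq_mul, RingHom.id_apply, smul_sub, smul_smul, Finset.mul_sum]
    congr 2
    exact Finset.sum_congr rfl fun k _ => by ring

lemma rootRefl_single (A : Matrix I I ℤ) (i j : I) :
    rootRefl A i (Pi.single j 1) = Pi.single j 1 - A i j • Pi.single i 1 := by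
  simp [rootRefl, Pi.single_apply]

lemma rootRefl_apply (A : Matrix I I ℤ) (i : I) (v : I → ℤ) :
    rootRefl A i v = v - bf A i v • Pi.single i 1 := rfl

variable {A : Matrix I I ℤ}

lemma cox_three {i j : I} (hij : i ≠ j) (h : A i j = -1) : coxeterMatrixOfCartan A i j = 3 := by
  show (if i = j then 1 else if A i j = -1 ∨ A j i = -1 then 3 else 2) = 3
  simp [hij, h]

lemma cox_two (hA : IsADECartanMatrix A) {i j : I} (hij : i ≠ j) (h : A i j = 0) :
    coxeterMatrixOfCartan A i j = 2 := by
  show (if i = j then 1 else if A i j = -1 ∨ A j i = -1 then 3 else 2) = 2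
  have := hA.symm i j
  simp [hij, h, ← this]

lemma rootRefl_liftable (hA : IsADECartanMatrix A) :
    (coxeterMatrixOfCartan A).IsLiftable (rootRefl A) := by
  intro i j
  by_cases hij : i = j
  · subst hij
    rw [(coxeterMatrixOfCartan A).diagonal, pow_one]
    refine LinearMap.ext fun v => ?_
    simp only [Module.End.mul_apply, Module.End.one_apply, rootRefl_apply, bf_sub, bf_smul_single,
      hA.diag]
    module
  · rcases hA.off_diag i j hij with h | h
    · rw [cox_two hA hij h]
      refine LinearMap.ext fun v => ?_
      have h' : A j i = 0 := by rw [hA.symm, h]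
      simp only [pow_succ, pow_zero, one_mul, Module.End.mul_apply, Module.End.one_apply]
      simp only [rootRefl_apply, bf_sub, bf_smul_single, h, h', hA.diag]
      module
    · rw [cox_three hij h]
      refine LinearMap.ext fun v => ?_
      have h' : A j i = -1 := by rw [hA.symm, h]
      simp only [pow_succ, pow_zero, one_mul, Module.End.mul_apply, Module.End.one_apply]
      simp only [rootRefl_apply, bf_sub, bf_smul_single, h, h', hA.diag]
      module

variable {W : Type*} [Group W] (cs : CoxeterSystem (coxeterMatrixOfCartan A) W)

/-- simple root -/
abbrev sr (i : I) : I → ℤ := Pi.single i 1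

/-- The reflection representation. -/
structure IsRootRep (ρ : W →* Module.End ℤ (I → ℤ)) : Prop where
  cartan : IsADECartanMatrix A
  act : ∀ i j, ρ (cs.simple i) (sr j) = sr j - A i j • sr i

lemma exists_refl (hA : IsADECartanMatrix A) : ∃ ρ, IsRootRep cs ρ :=
  ⟨cs.lift ⟨rootRefl A, rootRefl_liftable hA⟩, hA, fun i j => by
    rw [cs.lift_apply_simple, rootRefl_single]⟩

variable {cs} {ρ : W →* Module.End ℤ (I → ℤ)}

namespace IsRootRep

lemma act_self (H : IsRootRep cs ρ) (w : W) (i : I) : ρ (w * cs.simple i) (sr i) = - ρ w (sr i) := by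
  rw [map_mul, Module.End.mul_apply, H.act, H.cartan.diag, ← map_neg]
  congr 1; module

lemma act_zero (H : IsRootRep cs ρ) (w : W) {i j : I} (h : A i j = 0) :
    ρ (w * cs.simple i) (sr j) = ρ w (sr j) := by
  rw [map_mul, Module.End.mul_apply, H.act, h, zero_smul, sub_zero]

lemma act_one (H : IsRootRep cs ρ) (w : W) {i j : I} (h : A i j = -1) :
    ρ (w * cs.simple i) (sr j) = ρ w (sr j) + ρ w (sr i) := by
  rw [map_mul, Module.End.mul_apply, H.act, h, ← map_add]
  congr 1; module

lemma act_two (H : IsRootRep cs ρ) (w : W) {i j : I} (h : A i j = -1) :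
    ρ (w * cs.simple i * cs.simple j) (sr i) = ρ w (sr j) := by
  rw [H.act_one _ (by rw [H.cartan.symm, h]), H.act_self, H.act_one _ h]
  abel

lemma comm (H : IsRootRep cs ρ) {i j : I} (hij : i ≠ j) (h : A i j = 0) :
    cs.simple i * cs.simple j = cs.simple j * cs.simple i := by
  have := cs.simple_mul_simple_pow i j
  rw [cox_two H.cartan hij h, pow_two] at this
  have h2 := eq_inv_of_mul_eq_one_left this
  simpa using h2

lemma braid (_H : IsRootRep cs ρ) {i j : I} (hij : i ≠ j) (h : A i j = -1) :
    cs.simple i * cs.simple j * cs.simple i = cs.simple j * cs.simple i * cs.simple j := by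
  have := cs.simple_mul_simple_pow i j
  rw [cox_three hij h] at this
  have h3 : (cs.simple i * cs.simple j * cs.simple i) * (cs.simple j * cs.simple i * cs.simple j) = 1 := by
    rw [← this]; simp only [pow_succ, pow_zero, one_mul, mul_assoc]
  have h2 := eq_inv_of_mul_eq_one_left h3
  simpa [mul_assoc] using h2

lemma pos_of_not_descent (H : IsRootRep cs ρ) : ∀ (n : ℕ) (w : W) (i : I), cs.length w = n →
    cs.length (w * cs.simple i) = cs.length w + 1 → 0 ≤ ρ w (sr i) := by
  intro n
  induction n using Nat.strong_induction_on with
  | _ n ih =>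
  intro w i hw hi
  by_cases h1 : w = 1
  · subst h1
    simp [sr]
  obtain ⟨j, hj⟩ := cs.exists_rightDescent_of_ne_one h1
  rw [cs.isRightDescent_iff] at hj
  obtain ⟨u, rfl⟩ : ∃ u, w = u * cs.simple j := ⟨w * cs.simple j, by simp⟩
  rw [cs.simple_mul_simple_cancel_right] at hj
  have hij : i ≠ j := by
    rintro rfl
    rw [cs.simple_mul_simple_cancel_right] at hi
    omega
  have huj : 0 ≤ ρ u (sr j) := ih (cs.length u) (by omega) u j rfl (by omega)
  rcases H.cartan.off_diag i j hij with h | h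
  · have h' : A j i = 0 := by rw [H.cartan.symm, h]
    rw [H.act_zero _ h']
    refine ih (cs.length u) (by omega) u i rfl ?_
    rw [mul_assoc, ← H.comm hij h, ← mul_assoc] at hi
    have a1 := cs.length_mul_simple (u * cs.simple i) j
    have a2 := cs.length_mul_simple u i
    omega
  · have h' : A j i = -1 := by rw [H.cartan.symm, h]
    rw [H.act_one _ h']
    rcases cs.length_mul_simple u i with h2 | h2
    · exact add_nonneg (ih (cs.length u) (by omega) u i rfl h2) huj
    · obtain ⟨v, rfl⟩ : ∃ v, u = v * cs.simple i := ⟨u * cs.simple i, by simp⟩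
      rw [cs.simple_mul_simple_cancel_right] at h2
      rw [← H.act_one _ h', H.act_two _ h]
      refine ih (cs.length v) (by omega) v j rfl ?_
      have e : v * cs.simple i * cs.simple j * cs.simple i =
          v * cs.simple j * cs.simple i * cs.simple j := by
        simpa only [mul_assoc] using congrArg (v * ·) (H.braid hij h)
      rw [e] at hi
      have a1 := cs.length_mul_simple (v * cs.simple j * cs.simple i) j
      have a2 := cs.length_mul_simple (v * cs.simple j) i
      have a3 := cs.length_mul_simple v j
      omega

lemma ne_zero (_H : IsRootRep cs ρ) (w : W) (i : I) : ρ w (sr i) ≠ 0 := by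
  intro h
  have : ρ (w⁻¹ * w) (sr i) = 0 := by rw [map_mul, Module.End.mul_apply, h, map_zero]
  simp [sr] at this

lemma pos (H : IsRootRep cs ρ) {w : W} {i : I} (h : cs.length (w * cs.simple i) = cs.length w + 1) :
    0 ≤ ρ w (sr i) := H.pos_of_not_descent _ w i rfl h

lemma neg (H : IsRootRep cs ρ) {w : W} {i : I} (h : cs.length (w * cs.simple i) + 1 = cs.length w) :
    ρ w (sr i) ≤ 0 := by
  have := H.pos (w := w * cs.simple i) (i := i) (by rw [cs.simple_mul_simple_cancel_right]; omega)
  rw [H.act_self] at this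
  simpa using this

lemma pos_iff (H : IsRootRep cs ρ) {w : W} {i : I} :
    cs.length (w * cs.simple i) = cs.length w + 1 ↔ 0 ≤ ρ w (sr i) := by
  refine ⟨H.pos, fun h => ?_⟩
  rcases cs.length_mul_simple w i with h' | h'
  · exact h'
  · exact absurd (le_antisymm (H.neg h') h) (H.ne_zero w i)

lemma neg_iff (H : IsRootRep cs ρ) {w : W} {i : I} :
    cs.length (w * cs.simple i) + 1 = cs.length w ↔ ρ w (sr i) ≤ 0 := by
  refine ⟨H.neg, fun h => ?_⟩
  rcases cs.length_mul_simple w i with h' | h'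
  · exact absurd (le_antisymm h (H.pos h')) (H.ne_zero w i)
  · exact h'

end IsRootRep

lemma reduced_concat {ω : List I} {i : I} (h : cs.IsReduced (ω ++ [i])) :
    cs.IsReduced ω ∧ cs.length (cs.wordProd ω * cs.simple i) = cs.length (cs.wordProd ω) + 1 := by
  have h1 : cs.IsReduced ω := by simpa using h.take ω.length
  refine ⟨h1, ?_⟩
  have := h.eq
  rw [cs.wordProd_append, cs.wordProd_singleton] at this
  rw [this, h1.eq]; simp

lemma reduced_concat' {ω : List I} {i : I} (h1 : cs.IsReduced ω)
    (h : cs.length (cs.wordProd ω * cs.simple i) = cs.length (cs.wordProd ω) + 1) :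
    cs.IsReduced (ω ++ [i]) := by
  unfold CoxeterSystem.IsReduced
  rw [cs.wordProd_append, cs.wordProd_singleton, h, h1.eq]; simp

/-- The theorem of Matsumoto in the simply laced case. -/
lemma matsumoto (H : IsRootRep cs ρ) {M : Type*} [Monoid M] (T : I → M)
    (b2 : ∀ i j, i ≠ j → A i j = 0 → T i * T j = T j * T i)
    (b3 : ∀ i j, i ≠ j → A i j = -1 → T i * T j * T i = T j * T i * T j) :
    ∀ (n : ℕ) (ω ω' : List I), ω.length = n → cs.IsReduced ω → cs.IsReduced ω' →
      cs.wordProd ω = cs.wordProd ω' → (ω.map T).prod = (ω'.map T).prod := by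
  intro n
  induction n using Nat.strong_induction_on with
  | _ n ih =>
  intro ω ω' hn hω hω' hp
  have hlen : ω.length = ω'.length := by rw [← hω.eq, ← hω'.eq, hp]
  rcases List.eq_nil_or_concat' ω with rfl | ⟨ω₁, s, rfl⟩
  · have : ω' = [] := by simpa using hlen.symm
    rw [this]
  rcases List.eq_nil_or_concat' ω' with rfl | ⟨ω₂, t, rfl⟩
  · simp at hlen
  obtain ⟨r1, l1⟩ := reduced_concat hω
  obtain ⟨r2, l2⟩ := reduced_concat hω'
  simp only [cs.wordProd_append, cs.wordProd_singleton] at hp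
  simp only [List.length_append, List.length_singleton] at hn hlen
  simp only [List.map_append, List.prod_append, List.map_cons, List.map_nil, List.prod_singleton]
  by_cases hst : s = t
  · subst hst
    rw [ih ω₁.length (by omega) ω₁ ω₂ rfl r1 r2 (mul_right_cancel hp)]
  have ds : ρ (cs.wordProd ω₁ * cs.simple s) (sr s) ≤ 0 := by
    rw [H.act_self]; simpa using H.pos l1
  have dt : ρ (cs.wordProd ω₁ * cs.simple s) (sr t) ≤ 0 := by
    rw [hp, H.act_self]; simpa using H.pos l2
  rcases H.cartan.off_diag s t hst with h | h
  · -- commuting case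
    rw [H.act_zero _ h] at dt
    have d1 := H.neg_iff.2 dt
    obtain ⟨υ, rυ, hυ⟩ := cs.exists_isReduced (cs.wordProd ω₁ * cs.simple t)
    have p1 : cs.wordProd ω₁ = cs.wordProd (υ ++ [t]) := by
      rw [cs.wordProd_append, ← hυ]; simp
    have p2 : cs.wordProd ω₂ = cs.wordProd (υ ++ [s]) := by
      rw [cs.wordProd_append, ← hυ, cs.wordProd_singleton, mul_assoc, ← H.comm hst h, ← mul_assoc,
        hp]; simp
    have q1 : cs.IsReduced (υ ++ [t]) := by
      apply reduced_concat' rυ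
      rw [← hυ, cs.simple_mul_simple_cancel_right]; omega
    have q2 : cs.IsReduced (υ ++ [s]) := by
      have := q1.eq
      unfold CoxeterSystem.IsReduced
      rw [← p2, r2.eq]
      rw [← p1, r1.eq] at this
      simp at this ⊢; omega
    rw [ih ω₁.length (by omega) ω₁ _ rfl r1 q1 p1, ih ω₂.length (by omega) ω₂ _ rfl r2 q2 p2]
    simp [mul_assoc, b2 s t hst h]
  · have h' : A t s = -1 := by rw [H.cartan.symm, h]
    have d1 : ρ (cs.wordProd ω₁) (sr t) ≤ 0 := by
      have e : ρ (cs.wordProd ω₁) (sr t) = ρ (cs.wordProd ω₁ * cs.simple s) (sr t) +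
          ρ (cs.wordProd ω₁ * cs.simple s) (sr s) := by
        rw [H.act_one _ h, H.act_self]; abel
      rw [e]; exact add_nonpos dt ds
    have d2 : ρ (cs.wordProd ω₁ * cs.simple t) (sr s) ≤ 0 := by
      rw [H.act_one _ h', add_comm]
      rwa [H.act_one _ h] at dt
    have d1 := H.neg_iff.2 d1
    have d2 := H.neg_iff.2 d2
    obtain ⟨υ, rυ, hυ⟩ := cs.exists_isReduced (cs.wordProd ω₁ * cs.simple t * cs.simple s)
    have p1 : cs.wordProd ω₁ = cs.wordProd (υ ++ [s] ++ [t]) := by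
      rw [cs.wordProd_append, cs.wordProd_append, ← hυ]; simp
    have p2 : cs.wordProd ω₂ = cs.wordProd (υ ++ [t] ++ [s]) := by
      rw [cs.wordProd_append, cs.wordProd_append, ← mul_left_inj (cs.simple t), ← hp, p1]
      simp only [cs.wordProd_append, cs.wordProd_singleton, mul_assoc]
      have := H.braid hst h
      simp only [mul_assoc] at this
      rw [this]
    have q0 : cs.IsReduced (υ ++ [s]) := by
      apply reduced_concat' rυ
      rw [← hυ, cs.simple_mul_simple_cancel_right]; omega
    have q1 : cs.IsReduced (υ ++ [s] ++ [t]) := by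
      apply reduced_concat' q0
      rw [cs.wordProd_append, ← hυ, cs.wordProd_singleton, cs.simple_mul_simple_cancel_right,
        cs.simple_mul_simple_cancel_right]; omega
    have q2 : cs.IsReduced (υ ++ [t] ++ [s]) := by
      have := q1.eq
      unfold CoxeterSystem.IsReduced
      rw [← p2, r2.eq]
      rw [← p1, r1.eq] at this
      simp at this ⊢; omega
    rw [ih ω₁.length (by omega) ω₁ _ rfl r1 q1 p1, ih ω₂.length (by omega) ω₂ _ rfl r2 q2 p2]
    have := b3 s t hst h
    simp only [mul_assoc] at this
    simp [mul_assoc, this]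

/-- Transport of a family of vectors along reduced words. -/
lemma transport (H : IsRootRep cs ρ) {V : Type*} [AddCommGroup V] [Module ℂ V]
    (T : I → Module.End ℂ V) (x : I → V)
    (b2 : ∀ i j, i ≠ j → A i j = 0 → T i * T j = T j * T i)
    (b3 : ∀ i j, i ≠ j → A i j = -1 → T i * T j * T i = T j * T i * T j)
    (x2 : ∀ i j, i ≠ j → A i j = 0 → T i (x j) = x j)
    (x3 : ∀ i j, i ≠ j → A i j = -1 → T i (T j (x i)) = x j) :
    ∀ (n : ℕ) (ω : List I) (i j : I), ω.length = n → cs.IsReduced ω →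
      ρ (cs.wordProd ω) (sr i) = sr j → (ω.map T).prod (x i) = x j := by
  intro n
  induction n using Nat.strong_induction_on with
  | _ n ih =>
  intro ω i j hn hω hij
  rcases List.eq_nil_or_concat' ω with rfl | ⟨ω₁, k, rfl⟩
  · have hij : (sr i : I → ℤ) = sr j := by simpa using hij
    have : i = j := by
      by_contra hne
      have := congrFun hij i
      simp [sr, Pi.single_apply, hne] at this
    simp [this]
  obtain ⟨r1, l1⟩ := reduced_concat hω
  simp only [cs.wordProd_append, cs.wordProd_singleton] at hij
  simp only [List.length_append, List.length_singleton] at hn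
  simp only [List.map_append, List.prod_append, List.map_cons, List.map_nil, List.prod_singleton,
    Module.End.mul_apply]
  have pk := H.pos l1
  have sj : (0 : I → ℤ) ≤ sr j := by simp [sr]
  have hki : k ≠ i := by
    rintro rfl
    rw [H.act_self] at hij
    have : ρ (cs.wordProd ω₁) (sr k) ≤ 0 := by rw [← neg_nonneg, hij]; exact sj
    exact H.ne_zero _ _ (le_antisymm this pk)
  rcases H.cartan.off_diag k i hki with h | h
  · rw [x2 k i hki h]
    rw [H.act_zero _ h] at hij
    exact ih _ (by omega) ω₁ i j rfl r1 hij
  · have h' : A i k = -1 := by rw [H.cartan.symm, h]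
    rcases cs.length_mul_simple (cs.wordProd ω₁) i with l2 | l2
    · exfalso
      have pi := H.pos l2
      rw [H.act_one _ h] at hij
      obtain ⟨a, ha⟩ := Function.ne_iff.1 (H.ne_zero (cs.wordProd ω₁) i)
      obtain ⟨b, hb⟩ := Function.ne_iff.1 (H.ne_zero (cs.wordProd ω₁) k)
      have ea := congrFun hij a
      have eb := congrFun hij b
      have ia := pi a
      have ib := pi b
      have ka := pk a
      have kb := pk b
      simp only [Pi.add_apply, Pi.zero_apply, sr, Pi.single_apply] at *
      have aj : a = j := by
        by_contra hne
        rw [if_neg hne] at ea; omega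
      have bj : b = j := by
        by_contra hne
        rw [if_neg hne] at eb; omega
      subst aj; subst bj
      simp at ea
      omega
    · obtain ⟨υ, rυ, hυ⟩ := cs.exists_isReduced (cs.wordProd ω₁ * cs.simple i)
      have p1 : cs.wordProd ω₁ = cs.wordProd (υ ++ [i]) := by
        rw [cs.wordProd_append, ← hυ]; simp
      have q1 : cs.IsReduced (υ ++ [i]) := by
        apply reduced_concat' rυ
        rw [← hυ, cs.simple_mul_simple_cancel_right]; omega
      rw [matsumoto H T b2 b3 _ ω₁ _ rfl r1 q1 p1]
      simp only [List.map_append, List.prod_append, List.map_cons, List.map_nil,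
        List.prod_singleton, Module.End.mul_apply]
      rw [x3 i k hki.symm h']
      have hl : υ.length < n := by rw [← rυ.eq, ← hυ]; rw [r1.eq] at l2; omega
      refine ih _ hl υ k j rfl rυ ?_
      rw [p1, cs.wordProd_append, cs.wordProd_singleton, H.act_two _ h'] at hij
      exact hij

lemma longest_neg (H : IsRootRep cs ρ) {w₀ : W} (hw₀ : ∀ w : W, cs.length w ≤ cs.length w₀) (i : I) :
    ρ w₀ (sr i) ≤ 0 := by
  rw [← H.neg_iff]
  have := hw₀ (w₀ * cs.simple i)
  have := cs.length_mul_simple w₀ i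
  omega

lemma longest_perm (H : IsRootRep cs ρ) {w₀ : W} (hw₀ : ∀ w : W, cs.length w ≤ cs.length w₀) (i : I) :
    ∃ j, ρ w₀ (sr i) = - sr j := by
  have hinv : ∀ w : W, cs.length w ≤ cs.length w₀⁻¹ := by simpa using hw₀
  set v := - ρ w₀ (sr i) with hv
  have vpos : 0 ≤ v := by simpa [hv] using longest_neg H hw₀ i
  -- `w₀⁻¹` sends `v` to `- sr i`
  set u : I → I → ℤ := fun k => - ρ w₀⁻¹ (sr k) with hu
  have upos : ∀ k, 0 ≤ u k := fun k => by simpa [hu] using longest_neg H hinv k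
  have uht : ∀ k, 1 ≤ ∑ a, u k a := by
    intro k
    have h0 : 0 ≤ ∑ a, u k a := Finset.sum_nonneg fun a _ => upos k a
    by_contra hlt
    have h1 : ∑ a, u k a = 0 := by omega
    rw [Finset.sum_eq_zero_iff_of_nonneg fun a _ => upos k a] at h1
    apply H.ne_zero w₀⁻¹ k
    funext a
    have := h1 a (Finset.mem_univ a)
    simpa [hu] using this
  have vsum : v = ∑ k, v k • sr k := by
    funext a
    simp [sr, Pi.single_apply, Finset.sum_apply]
  have e1 : ρ w₀⁻¹ v = - sr i := by
    rw [hv, map_neg, ← Module.End.mul_apply, ← map_mul]; simp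
  have e2 : (sr i : I → ℤ) = ∑ k, v k • u k := by
    rw [vsum, map_sum] at e1
    simp only [map_smul] at e1
    rw [← neg_inj, ← e1, ← Finset.sum_neg_distrib]
    exact Finset.sum_congr rfl fun k _ => by simp [hu]
  have e3 : (1 : ℤ) = ∑ k, v k * ∑ a, u k a := by
    have := congrArg (fun z : I → ℤ => ∑ a, z a) e2
    simp only [Finset.sum_apply, Pi.smul_apply, smul_eq_mul] at this
    rw [Finset.sum_comm] at this
    simpa [sr, Finset.mul_sum] using this
  have e4 : ∑ k, v k ≤ 1 := by
    rw [e3]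
    refine Finset.sum_le_sum fun k _ => ?_
    nlinarith [vpos k, uht k, show 0 ≤ v k from vpos k]
  have vne : v ≠ 0 := by simpa [hv] using H.ne_zero w₀ i
  obtain ⟨j, hj⟩ := Function.ne_iff.1 vne
  refine ⟨j, ?_⟩
  rw [← neg_eq_iff_eq_neg]
  change v = sr j
  funext a
  have hj' : 0 < v j := lt_of_le_of_ne (vpos j) (Ne.symm hj)
  have hsplit : v j + ∑ k ∈ Finset.univ.erase j, v k = ∑ k, v k :=
    Finset.add_sum_erase _ _ (Finset.mem_univ j)
  have hnn : 0 ≤ ∑ k ∈ Finset.univ.erase j, v k := Finset.sum_nonneg fun k _ => vpos k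
  by_cases haj : a = j
  · subst haj
    simp [sr]; omega
  · have : v a ≤ ∑ k ∈ Finset.univ.erase j, v k :=
      Finset.single_le_sum (f := v) (fun k _ => vpos k) (by simp [haj])
    have h0 : 0 ≤ v a := vpos a
    simp [sr, haj]; omega

lemma longest_sq (H : IsRootRep cs ρ) {w₀ : W} (hw₀ : ∀ w : W, cs.length w ≤ cs.length w₀) :
    w₀ * w₀ = 1 := by
  by_contra hne
  obtain ⟨i, hi⟩ := cs.exists_rightDescent_of_ne_one hne
  rw [cs.isRightDescent_iff, H.neg_iff] at hi
  obtain ⟨j, hj⟩ := longest_perm H hw₀ i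
  obtain ⟨k, hk⟩ := longest_perm H hw₀ j
  rw [map_mul, Module.End.mul_apply, hj, map_neg, hk] at hi
  have := hi k
  simp [sr] at this

end CoxeterSide

lemma tauWord_longest {A : Matrix I I ℤ} {e f h : I → L} (hCS : IsChevalleySystem A e f h)
    {W : Type*} [Group W] {cs : CoxeterSystem (coxeterMatrixOfCartan A) W}
    {ρ : W →* Module.End ℤ (I → ℤ)} (H : IsRootRep cs ρ)
    {w₀ : W} (hw₀ : ∀ w : W, cs.length w ≤ cs.length w₀)
    (ω : List I) (hprod : cs.wordProd ω = w₀) (hred : cs.IsReduced ω) (i j : I)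
    (hij : ρ w₀ (sr i) = - sr j) :
    tauWord e f ω (e i) = - f j ∧ tauWord e f ω (f i) = - e j := by
  have b2 := fun i j (hij : i ≠ j) (hA : A i j = 0) => hCS.braid2 hij hA
  have b3 := fun i j (hij : i ≠ j) (hA : A i j = -1) => hCS.braid3 hij hA
  have d := H.neg_iff.2 (longest_neg H hw₀ i)
  obtain ⟨υ, rυ, hυ⟩ := cs.exists_isReduced (w₀ * cs.simple i)
  have p1 : cs.wordProd ω = cs.wordProd (υ ++ [i]) := by
    rw [cs.wordProd_append, ← hυ, hprod]; simp
  have q1 : cs.IsReduced (υ ++ [i]) := by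
    apply reduced_concat' rυ
    rw [← hυ, cs.simple_mul_simple_cancel_right]; omega
  have r : ρ (cs.wordProd υ) (sr i) = sr j := by
    rw [← hυ, H.act_self, hij, neg_neg]
  have te := transport H (chevalleyTau e f) e b2 b3
    (fun i j hij hA => hCS.tau_e_zero hij hA) (fun i j hij hA => hCS.tau_tau_e hij hA)
    _ υ i j rfl rυ r
  have tf := transport H (chevalleyTau e f) f b2 b3
    (fun i j hij hA => hCS.tau_f_zero hij hA) (fun i j hij hA => hCS.tau_tau_f hij hA)
    _ υ i j rfl rυ r
  unfold tauWord
  rw [matsumoto H (chevalleyTau e f) b2 b3 _ ω _ rfl hred q1 p1]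
  simp only [List.map_append, List.prod_append, List.map_cons, List.map_nil,
    List.prod_singleton, Module.End.mul_apply]
  rw [hCS.tau_e_self, hCS.tau_f_self, map_neg, map_neg, te, tf]
  exact ⟨rfl, rfl⟩

/-- for every reduced expression `w₀ = s_{i₁} s_{i₂} ⋯ s_{i_l}` of the
longest element of the Weyl group `W`, the automorphism `τ = τ_{i₁} ∘ τ_{i₂} ∘ ⋯ ∘ τ_{i_l}`
of `L` satisfies `τ(τ(eᵢ)) = eᵢ` for every `i` (consistency of the inductively
constructed root vectors in the classical, `q = 1`, case). -/
theorem tauWord_longest_element_squared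
    (A : Matrix I I ℤ) (e f h : I → L) (hCS : IsChevalleySystem A e f h)
    {W : Type*} [Group W] [Finite W]
    (cs : CoxeterSystem (coxeterMatrixOfCartan A) W)
    (w₀ : W) (hw₀ : ∀ w : W, cs.length w ≤ cs.length w₀)
    (ω : List I) (hprod : cs.wordProd ω = w₀) (hred : cs.IsReduced ω) :
    ∀ i : I, tauWord e f ω (tauWord e f ω (e i)) = e i := by
  intro i
  obtain ⟨ρ, H⟩ := exists_refl cs hCS.cartan
  obtain ⟨j, hj⟩ := longest_perm H hw₀ i
  have hk : ρ w₀ (sr j) = - sr i := by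
    have h1 : ρ (w₀ * w₀) (sr i) = sr i := by rw [longest_sq H hw₀]; simp
    rw [map_mul, Module.End.mul_apply, hj, map_neg] at h1
    rw [← h1, neg_neg]
  rw [(tauWord_longest hCS H hw₀ ω hprod hred i j hj).1, map_neg,
    (tauWord_longest hCS H hw₀ ω hprod hred j i hk).2, neg_neg]
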